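/- arXiv:1305.2898 — 3 statements merged into one kernel-verified Lean document; each statement's English description precedes it below -/
import Mathlib

section
/- Let (V_λ)_{λ∈𝔻} be a holomorphic family of horizontal submanifolds of degree k in 𝔹, as in the context. Assume: (i) there is a compact set Λ₀ ⊂ 𝔻 such that for every λ ∈ 𝔻 ∖ Λ₀, V_λ is a union of k pairwise disjoint horizontal graphs; (ii) there exists λ₀ ∈ 𝔻 such that V_{λ₀} is not a union of horizontal graphs. Then for every holomorphic map g : 𝔻 × 𝔻 → 𝔻, defining the vertical graphs W_λ = {(g(λ, w), w) : w ∈ 𝔻}, there exists λ₁ ∈ 𝔻 at which V_{λ₁} and W_{λ₁} admit a point of tangency; equivalently, the holomorphic function w ↦ F(λ₁, (g(λ₁, w), w)) on 𝔻 has a zero of multiplicity at least 2. -/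
open Filter Metric Set
open scoped Topology

/-- A complex differentiable map on an open subset of a complex normed space has a continuous
derivative. -/
theorem continuousAt_fderiv_of_differentiableOn {E : Type*} [NormedAddCommGroup E]
    [NormedSpace ℂ E] {f : E → ℂ} {U : Set E} (hU : IsOpen U) (hf : DifferentiableOn ℂ f U)
    {x : E} (hx : x ∈ U) : ContinuousAt (fderiv ℂ f) x := by
  have hfd : ∀ y ∈ U, DifferentiableAt ℂ f y := fun y hy => hf.differentiableAt (hU.mem_nhds hy)
  obtain ⟨r, hr, hball⟩ : ∃ r > 0, ∀ y ∈ ball x (3 * r), y ∈ U ∧ dist (f y) (f x) ≤ 1 := by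
    have h1 : ∀ᶠ y in 𝓝 x, y ∈ U ∧ dist (f y) (f x) ≤ 1 :=
      (hU.eventually_mem hx).and <|
        ((hfd x hx).continuousAt.eventually (closedBall_mem_nhds (f x) one_pos))
    obtain ⟨δ, hδ, h⟩ := Metric.eventually_nhds_iff_ball.1 h1
    exact ⟨δ / 3, by positivity, fun y hy => h y (by rwa [mul_div_cancel₀ _ (by norm_num)] at hy)⟩
  have hbound : ∀ y ∈ ball x (2 * r), ‖fderiv ℂ f y‖ ≤ 2 / r := by
    intro y hy
    have hsub : ball y r ⊆ ball x (3 * r) :=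
      ball_subset_ball' (by rw [mem_ball] at hy; linarith)
    refine Complex.norm_fderiv_le_div_of_mapsTo_ball
      (fun z hz => (hfd z (hball z (hsub hz)).1).differentiableWithinAt) (fun z hz => ?_) hr
    have h1 := (hball z (hsub hz)).2
    have h2 := (hball y (hsub (mem_ball_self hr))).2
    rw [mem_closedBall]
    linarith [dist_triangle_right (f z) (f y) (f x)]
  have hLip : ∀ y ∈ ball x (2 * r), ∀ z ∈ ball x (2 * r), ‖f z - f y‖ ≤ 2 / r * ‖z - y‖ :=
    fun y hy z hz => (convex_ball x (2 * r)).norm_image_sub_le_of_norm_fderiv_le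
      (fun v hv => hfd v (hball v (ball_subset_ball (by linarith) hv)).1) hbound hy hz
  have hder : ∀ y ∈ ball x r, ‖fderiv ℂ f y - fderiv ℂ f x‖ ≤ 4 / r ^ 2 * ‖y - x‖ := by
    intro y hy
    have hshift : ∀ z ∈ ball x r, z + (y - x) ∈ ball x (2 * r) := by
      intro z hz
      rw [mem_ball, dist_eq_norm] at *
      calc ‖z + (y - x) - x‖ = ‖(z - x) + (y - x)‖ := by congr 1; abel
        _ ≤ ‖z - x‖ + ‖y - x‖ := norm_add_le _ _
        _ < 2 * r := by linarith
    have hin : ∀ z ∈ ball x r, z ∈ ball x (2 * r) :=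
      fun z hz => ball_subset_ball (by linarith) hz
    have hU2 : ∀ z ∈ ball x (2 * r), DifferentiableAt ℂ f z :=
      fun v hv => hfd v (hball v (ball_subset_ball (by linarith) hv)).1
    have hD : ∀ z ∈ ball x r, HasFDerivAt (fun z => f (z + (y - x)) - f z)
        (fderiv ℂ f (z + (y - x)) - fderiv ℂ f z) z := by
      intro z hz
      refine HasFDerivAt.sub ?_ (hU2 z (hin z hz)).hasFDerivAt
      exact (hasFDerivAt_comp_add_right (y - x)).2 (hU2 _ (hshift z hz)).hasFDerivAt
    have hle : ∀ z ∈ ball x r, ‖f (z + (y - x)) - f z‖ ≤ 2 / r * ‖y - x‖ := by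
      intro z hz
      simpa using hLip z (hin z hz) _ (hshift z hz)
    have key := Complex.norm_fderiv_le_div_of_mapsTo_ball (R₂ := 4 / r * ‖y - x‖)
      (fun z hz => (hD z hz).differentiableAt.differentiableWithinAt) (fun z hz => ?_) hr
    · rw [(hD x (mem_ball_self hr)).fderiv] at key
      simpa [div_mul_eq_mul_div, div_div, sq] using key
    · rw [mem_closedBall, dist_eq_norm]
      refine (norm_sub_le _ _).trans ?_
      have h1 := hle z hz
      have h2 := hle x (mem_ball_self hr)
      have h3 : 4 / r * ‖y - x‖ = 2 / r * ‖y - x‖ + 2 / r * ‖y - x‖ := by ring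
      linarith
  rw [ContinuousAt, tendsto_iff_norm_sub_tendsto_zero]
  refine squeeze_zero' (Eventually.of_forall fun _ => norm_nonneg _)
    ((isOpen_ball.eventually_mem (mem_ball_self hr)).mono hder) ?_
  have : ContinuousAt (fun y => 4 / r ^ 2 * ‖y - x‖) x := by fun_prop
  simpa [ContinuousAt] using this

theorem hasStrictFDerivAt_of_differentiableOn {E : Type*} [NormedAddCommGroup E]
    [NormedSpace ℂ E] {f : E → ℂ} {U : Set E} (hU : IsOpen U) (hf : DifferentiableOn ℂ f U)
    {x : E} (hx : x ∈ U) : HasStrictFDerivAt f (fderiv ℂ f x) x :=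
  hasStrictFDerivAt_of_hasFDerivAt_of_continuousAt
    ((hU.eventually_mem hx).mono fun _ hy =>
      (hf.differentiableAt (hU.mem_nhds hy)).hasFDerivAt)
    (continuousAt_fderiv_of_differentiableOn hU hf hx)

section PartialDerivative

variable {P : Type*} [NormedAddCommGroup P] [NormedSpace ℂ P] {Ψ : P × ℂ → ℂ} {U : Set (P × ℂ)}

theorem hasDerivAt_snd {u : P × ℂ} (h : DifferentiableAt ℂ Ψ u) :
    HasDerivAt (fun w => Ψ (u.1, w)) (fderiv ℂ Ψ u (0, 1)) u.2 := by
  have h2 : HasDerivAt (fun w : ℂ => (u.1, w)) ((0 : P), (1 : ℂ)) u.2 :=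
    (hasDerivAt_const u.2 u.1).prodMk (hasDerivAt_id u.2)
  exact h.hasFDerivAt.comp_hasDerivAt u.2 h2

theorem continuousOn_deriv_snd (hU : IsOpen U) (hΨ : DifferentiableOn ℂ Ψ U) :
    ContinuousOn (fun u : P × ℂ => deriv (fun w => Ψ (u.1, w)) u.2) U := by
  have h : ContinuousOn (fun u : P × ℂ => fderiv ℂ Ψ u (0, 1)) U := fun u hu =>
    ((continuousAt_fderiv_of_differentiableOn hU hΨ hu).clm_apply
      continuousAt_const).continuousWithinAt
  exact h.congr fun u hu => (hasDerivAt_snd (hΨ.differentiableAt (hU.mem_nhds hu))).deriv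

/-- Near a simple zero, `Ψ (p, ·)` has at most one zero. -/
theorem eventually_zero_unique (hU : IsOpen U) (hΨ : DifferentiableOn ℂ Ψ U) {u : P × ℂ}
    (hu : u ∈ U) (hd : deriv (fun w => Ψ (u.1, w)) u.2 ≠ 0) :
    ∀ᶠ q : (P × ℂ) × (P × ℂ) in 𝓝 (u, u),
      q.1.1 = q.2.1 → Ψ q.1 = 0 → Ψ q.2 = 0 → q.1.2 = q.2.2 := by
  have hs := hasStrictFDerivAt_of_differentiableOn hU hΨ hu
  rw [(hasDerivAt_snd (hΨ.differentiableAt (hU.mem_nhds hu))).deriv] at hd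
  have hpos : 0 < ‖fderiv ℂ Ψ u (0, 1)‖ / 2 := by positivity
  filter_upwards [hs.isLittleO.def hpos] with q hq h1 h2 h3
  by_contra hne
  have hsub : q.1 - q.2 = (q.1.2 - q.2.2) • ((0 : P), (1 : ℂ)) := by
    ext <;> simp [h1]
  have hn : 0 < ‖q.1.2 - q.2.2‖ := norm_pos_iff.2 (sub_ne_zero.2 hne)
  rw [h2, h3, hsub, map_smul] at hq
  simp only [sub_self, zero_sub, norm_neg, norm_smul] at hq
  have : ‖((0 : P), (1 : ℂ))‖ = 1 := by simp [Prod.norm_def]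
  rw [this] at hq
  nlinarith [mul_pos hn hpos]

/-- Over a compact set of parameters for which all zeros are simple, pairs of distinct zeros form
a compact set. -/
theorem isCompact_distinct_zeros (hU : IsOpen U) (hΨ : DifferentiableOn ℂ Ψ U) {Q : Set P}
    {B : Set ℂ} (hQ : IsCompact Q) (hB : IsCompact B) (hsub : Q ×ˢ B ⊆ U)
    (hs : ∀ p ∈ Q, ∀ w ∈ B, Ψ (p, w) = 0 → deriv (fun z => Ψ (p, z)) w ≠ 0) :
    IsCompact {x : P × (ℂ × ℂ) | (x.1 ∈ Q ∧ x.2.1 ∈ B ∧ x.2.2 ∈ B) ∧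
      (Ψ (x.1, x.2.1) = 0 ∧ Ψ (x.1, x.2.2) = 0) ∧ x.2.1 ≠ x.2.2} := by
  have hK : IsCompact (Q ×ˢ (B ×ˢ B)) := hQ.prod (hB.prod hB)
  have hc := hΨ.continuousOn
  have hC : IsClosed ((Q ×ˢ (B ×ˢ B)) ∩
      (fun x : P × (ℂ × ℂ) => (Ψ (x.1, x.2.1), Ψ (x.1, x.2.2))) ⁻¹' {0}) := by
    refine ContinuousOn.preimage_isClosed_of_isClosed ?_ hK.isClosed isClosed_singleton
    refine ContinuousOn.prodMk (hc.comp (by fun_prop) ?_) (hc.comp (by fun_prop) ?_)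
    · exact fun x hx => hsub ⟨hx.1, hx.2.1⟩
    · exact fun x hx => hsub ⟨hx.1, hx.2.2⟩
  refine hK.of_isClosed_subset (isClosed_of_closure_subset fun x hx => ?_)
    fun x hx => ⟨hx.1.1, hx.1.2.1, hx.1.2.2⟩
  have hxC := closure_minimal (t := _) (fun y hy => ?_) hC hx
  · obtain ⟨⟨h1, h2, h3⟩, h4⟩ := hxC
    simp only [mem_preimage, mem_singleton_iff, Prod.mk_eq_zero] at h4
    refine ⟨⟨h1, h2, h3⟩, h4, fun heq => ?_⟩
    have hun := eventually_zero_unique hU hΨ (u := (x.1, x.2.1)) (hsub ⟨h1, h2⟩)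
      (hs _ h1 _ h2 h4.1)
    have hcont : ContinuousAt
        (fun y : P × (ℂ × ℂ) => ((y.1, y.2.1), (y.1, y.2.2))) x := by fun_prop
    have hcont' : Tendsto (fun y : P × (ℂ × ℂ) => ((y.1, y.2.1), (y.1, y.2.2))) (𝓝 x)
        (𝓝 ((x.1, x.2.1), (x.1, x.2.1))) := by
      simpa [ContinuousAt, ← heq] using hcont
    obtain ⟨y, hy, hyS⟩ := ((mem_closure_iff_frequently.1 hx).and_eventually
      (hcont'.eventually hun)).exists
    exact hy.2.2 (hyS rfl hy.2.1.1 hy.2.1.2)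
  · exact ⟨⟨hy.1.1, hy.1.2.1, hy.1.2.2⟩, by simp [hy.2.1]⟩

end PartialDerivative

/-- Holomorphic implicit function theorem for curves in `ℂ²`. -/
theorem exists_implicit_function {G : ℂ × ℂ → ℂ} {U : Set (ℂ × ℂ)} (hU : IsOpen U)
    (hG : DifferentiableOn ℂ G U) {u : ℂ × ℂ} (hu : u ∈ U) (h0 : G u = 0)
    (hd : deriv (fun w => G (u.1, w)) u.2 ≠ 0) :
    ∃ h : ℂ → ℂ, DifferentiableAt ℂ h u.1 ∧ h u.1 = u.2 ∧
      ∀ᶠ v in 𝓝 u, G v = 0 ↔ h v.1 = v.2 := by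
  have hs := hasStrictFDerivAt_of_differentiableOn hU hG hu
  rw [(hasDerivAt_snd (hG.differentiableAt (hU.mem_nhds hu))).deriv] at hd
  have hinv : (fderiv ℂ G u ∘L .inr ℂ ℂ ℂ).IsInvertible := by
    refine ⟨ContinuousLinearEquiv.unitsEquivAut ℂ (Units.mk0 _ hd), ?_⟩
    ext
    simp
  have hev := hs.eventually_apply_eq_iff_implicitFunctionOfProdDomain hinv
  rw [h0] at hev
  exact ⟨hs.implicitFunctionOfProdDomain hinv,
    (hs.hasStrictFDerivAt_implicitFunctionOfProdDomain hinv).hasFDerivAt.differentiableAt,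
    hev.self_of_nhds.1 h0, hev⟩

/-- The implicit function may be chosen holomorphic on a neighbourhood. -/
theorem exists_implicit_function_eventually {G : ℂ × ℂ → ℂ} {U : Set (ℂ × ℂ)} (hU : IsOpen U)
    (hG : DifferentiableOn ℂ G U) {u : ℂ × ℂ} (hu : u ∈ U) (h0 : G u = 0)
    (hd : deriv (fun w => G (u.1, w)) u.2 ≠ 0) :
    ∃ h : ℂ → ℂ, (∀ᶠ x in 𝓝 u.1, DifferentiableAt ℂ h x) ∧ h u.1 = u.2 ∧
      ∀ᶠ v in 𝓝 u, G v = 0 ↔ h v.1 = v.2 := by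
  obtain ⟨h, hdiff, hhu, hev⟩ := exists_implicit_function hU hG hu h0 hd
  refine ⟨h, ?_, hhu, hev⟩
  have hdne : ∀ᶠ v in 𝓝 u, deriv (fun w => G (v.1, w)) v.2 ≠ 0 :=
    ((continuousOn_deriv_snd hU hG).continuousAt (hU.mem_nhds hu)).eventually_ne hd
  have htend : Tendsto (fun x => (x, h x)) (𝓝 u.1) (𝓝 u) := by
    have : ContinuousAt (fun x => (x, h x)) u.1 := continuousAt_id.prodMk hdiff.continuousAt
    simpa [ContinuousAt, hhu] using this
  filter_upwards [htend.eventually hdne, htend.eventually hev.eventually_nhds,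
    htend.eventually (hU.mem_nhds hu)] with x hx1 hx2 hx3
  obtain ⟨k, hk1, hk2, hk3⟩ := exists_implicit_function hU hG hx3
    (hx2.self_of_nhds.2 rfl) hx1
  have hktend : Tendsto (fun y => (y, k y)) (𝓝 x) (𝓝 (x, h x)) := by
    have : ContinuousAt (fun y => (y, k y)) x := continuousAt_id.prodMk hk1.continuousAt
    simp only at hk2
    simpa [ContinuousAt, hk2] using this
  refine hk1.congr_of_eventuallyEq ?_
  filter_upwards [hktend.eventually hx2, hktend.eventually hk3] with y h1 h2
  exact h1.1 (h2.2 rfl)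

/-- Minimum modulus principle on a disc. -/
theorem le_norm_of_le_norm_sphere {q : ℂ → ℂ} {c : ℂ} {s m : ℝ} (hs : 0 < s) (hm : 0 < m)
    (hq : DifferentiableOn ℂ q (closedBall c s)) (hne : ∀ z ∈ closedBall c s, q z ≠ 0)
    (hsph : ∀ z ∈ sphere c s, m ≤ ‖q z‖) {z : ℂ} (hz : z ∈ closedBall c s) : m ≤ ‖q z‖ := by
  have hcl : closure (ball c s) = closedBall c s := closure_ball c hs.ne'
  have hd : DiffContOnCl ℂ (fun z => (q z)⁻¹) (ball c s) := by
    refine DifferentiableOn.diffContOnCl ?_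
    rw [hcl]
    exact hq.inv hne
  have := Complex.norm_le_of_forall_mem_frontier_norm_le (C := m⁻¹) isBounded_ball hd
    (fun w hw => ?_) (hcl ▸ hz)
  · rw [norm_inv] at this
    exact (inv_le_inv₀ (norm_pos_iff.2 (hne z hz)) hm).1 this
  · rw [frontier_ball c hs.ne'] at hw
    rw [norm_inv]
    exact inv_anti₀ hm (hsph w hw)

/-- Quantitative form of Hurwitz' theorem: a function with at most one zero in a disc, simple if
it exists, grows at least linearly away from any point where it is small. -/
theorem norm_sub_le_of_unique_simple_zero {f : ℂ → ℂ} {U : Set ℂ} (hU : IsOpen U)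
    (hf : DifferentiableOn ℂ f U) {c : ℂ} {s m : ℝ} (hs : 0 < s) (hm : 0 < m)
    (hsub : closedBall c s ⊆ U) (hsph : ∀ z ∈ sphere c s, m ≤ ‖f z‖)
    (huniq : ∀ z ∈ closedBall c s, ∀ w ∈ closedBall c s, f z = 0 → f w = 0 → z = w)
    (hsimple : ∀ z ∈ closedBall c s, f z = 0 → deriv f z ≠ 0)
    {z w : ℂ} (hz : z ∈ closedBall c s) (hw : w ∈ closedBall c s) :
    m / (2 * s) * ‖z - w‖ ≤ ‖f z‖ + ‖f w‖ := by
  have hk : 0 < m / (2 * s) := by positivity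
  obtain ⟨a, ha⟩ : ∃ a, ∀ z ∈ closedBall c s, m / (2 * s) * ‖z - a‖ ≤ ‖f z‖ := by
    have hdiam : ∀ a ∈ closedBall c s, ∀ z ∈ closedBall c s, ‖z - a‖ ≤ 2 * s := by
      intro a ha z hz
      rw [← dist_eq_norm]
      rw [mem_closedBall] at ha hz
      linarith [dist_triangle_right z a c]
    by_cases hex : ∃ a ∈ closedBall c s, f a = 0
    · obtain ⟨a, haB, ha0⟩ := hex
      refine ⟨a, fun z hz => ?_⟩
      have hprod : ∀ z, ‖z - a‖ * ‖dslope f a z‖ = ‖f z‖ := by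
        intro z
        rw [← norm_mul, ← smul_eq_mul, sub_smul_dslope, ha0, sub_zero]
      have hne : ∀ z ∈ closedBall c s, dslope f a z ≠ 0 := by
        intro z hz h0
        by_cases hza : z = a
        · rw [hza, dslope_same] at h0
          exact hsimple a haB ha0 h0
        · have h1 := hprod z
          rw [h0, norm_zero, mul_zero] at h1
          exact hza (huniq z hz a haB (norm_eq_zero.1 h1.symm) ha0)
      have hdiff : DifferentiableOn ℂ (dslope f a) (closedBall c s) :=
        ((Complex.differentiableOn_dslope (hU.mem_nhds (hsub haB))).2 hf).mono hsub
      have hlow := le_norm_of_le_norm_sphere hs hk hdiff hne (fun z hz => ?_) hz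
      · rw [← hprod z, mul_comm]
        exact mul_le_mul_of_nonneg_left hlow (norm_nonneg _)
      · rw [div_le_iff₀ (by positivity)]
        calc m ≤ ‖f z‖ := hsph z hz
          _ = ‖z - a‖ * ‖dslope f a z‖ := (hprod z).symm
          _ ≤ 2 * s * ‖dslope f a z‖ :=
            mul_le_mul_of_nonneg_right (hdiam a haB z (sphere_subset_closedBall hz))
              (norm_nonneg _)
          _ = ‖dslope f a z‖ * (2 * s) := mul_comm _ _
    · push Not at hex
      refine ⟨c, fun z hz => ?_⟩
      have hlow := le_norm_of_le_norm_sphere hs hm (hf.mono hsub) hex hsph hz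
      refine le_trans ?_ hlow
      rw [div_mul_eq_mul_div, div_le_iff₀ (by positivity)]
      exact mul_le_mul_of_nonneg_left (hdiam c (mem_closedBall_self hs.le) z hz) hm.le
  have h1 := ha z hz
  have h2 := ha w hw
  have h3 : ‖z - w‖ ≤ ‖z - a‖ + ‖w - a‖ := by
    simpa [dist_eq_norm] using dist_triangle_right z w a
  calc m / (2 * s) * ‖z - w‖ ≤ m / (2 * s) * (‖z - a‖ + ‖w - a‖) :=
        mul_le_mul_of_nonneg_left h3 hk.le
    _ = m / (2 * s) * ‖z - a‖ + m / (2 * s) * ‖w - a‖ := mul_add _ _ _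
    _ ≤ _ := add_le_add h1 h2

/-- Maximum principle for the separation of zeros: if all zeros of `G (x, ·)` are simple for
`‖x‖ ≤ r`, a lower bound for the distance between distinct zeros on the boundary circle persists
inside the disc. -/
theorem le_dist_zeros_of_le_on_sphere {G : ℂ × ℂ → ℂ} {U : Set (ℂ × ℂ)} (hU : IsOpen U)
    (hG : DifferentiableOn ℂ G U) {r ρ c₀ : ℝ}
    (hsub : closedBall (0 : ℂ) r ×ˢ closedBall (0 : ℂ) ρ ⊆ U)
    (hzero : ∀ x ∈ closedBall (0 : ℂ) r, ∀ w ∈ closedBall (0 : ℂ) ρ, G (x, w) = 0 →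
      w ∈ ball (0 : ℂ) ρ)
    (hsimple : ∀ x ∈ closedBall (0 : ℂ) r, ∀ w ∈ closedBall (0 : ℂ) ρ, G (x, w) = 0 →
      deriv (fun z => G (x, z)) w ≠ 0)
    (hc₀ : ∀ x ∈ sphere (0 : ℂ) r, ∀ w₁ ∈ closedBall (0 : ℂ) ρ, ∀ w₂ ∈ closedBall (0 : ℂ) ρ,
      G (x, w₁) = 0 → G (x, w₂) = 0 → w₁ ≠ w₂ → c₀ ≤ dist w₁ w₂) :
    ∀ x ∈ closedBall (0 : ℂ) r, ∀ w₁ ∈ closedBall (0 : ℂ) ρ, ∀ w₂ ∈ closedBall (0 : ℂ) ρ,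
      G (x, w₁) = 0 → G (x, w₂) = 0 → w₁ ≠ w₂ → c₀ ≤ dist w₁ w₂ := by
  intro x hx w₁ hw₁ w₂ hw₂ h₁ h₂ hne
  by_contra! hlt
  have hS := isCompact_distinct_zeros hU hG (isCompact_closedBall (0 : ℂ) r)
    (isCompact_closedBall (0 : ℂ) ρ) hsub hsimple
  set S := {x : ℂ × (ℂ × ℂ) | (x.1 ∈ closedBall (0 : ℂ) r ∧ x.2.1 ∈ closedBall (0 : ℂ) ρ ∧
    x.2.2 ∈ closedBall (0 : ℂ) ρ) ∧ (G (x.1, x.2.1) = 0 ∧ G (x.1, x.2.2) = 0) ∧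
    x.2.1 ≠ x.2.2} with hSdef
  have hxS : (x, (w₁, w₂)) ∈ S := ⟨⟨hx, hw₁, hw₂⟩, ⟨h₁, h₂⟩, hne⟩
  obtain ⟨y, hyS, hymin⟩ := hS.exists_isMinOn ⟨_, hxS⟩
    (f := fun y : ℂ × (ℂ × ℂ) => dist y.2.1 y.2.2) (by fun_prop)
  have hyc : dist y.2.1 y.2.2 < c₀ := (hymin hxS).trans_lt hlt
  set c := dist y.2.1 y.2.2 with hc
  have hcpos : 0 < c := dist_pos.2 hyS.2.2
  set A : Set ℂ := Prod.fst '' (S ∩ {y | dist y.2.1 y.2.2 = c}) with hA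
  have hAc : IsCompact A := by
    refine (hS.inter_right ?_).image continuous_fst
    exact isClosed_eq (by fun_prop) (by fun_prop)
  have hAo : IsOpen A := by
    rw [isOpen_iff_mem_nhds]
    rintro a ⟨⟨a, w, w'⟩, ⟨⟨⟨ha, hw, hw'⟩, ⟨h0, h0'⟩, hww'⟩, hdist⟩, rfl⟩
    simp only [mem_ofPred_eq] at ha hw hw' h0 h0' hww' hdist ⊢
    have har : a ∈ ball (0 : ℂ) r := by
      by_contra hnot
      have : a ∈ sphere (0 : ℂ) r := by
        rw [mem_sphere]
        rw [mem_closedBall] at ha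
        rw [mem_ball, not_lt] at hnot
        exact le_antisymm ha hnot
      linarith [hc₀ a this w hw w' hw' h0 h0' hww']
    obtain ⟨h, hd, hh, hev⟩ := exists_implicit_function_eventually hU hG (u := (a, w))
      (hsub ⟨ha, hw⟩) h0 (hsimple a ha w hw h0)
    obtain ⟨h', hd', hh', hev'⟩ := exists_implicit_function_eventually hU hG (u := (a, w'))
      (hsub ⟨ha, hw'⟩) h0' (hsimple a ha w' hw' h0')
    simp only at hd hh hd' hh'
    have hcont := hd.self_of_nhds.continuousAt
    have hcont' := hd'.self_of_nhds.continuousAt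
    have ht : Tendsto (fun x => (x, h x)) (𝓝 a) (𝓝 (a, w)) := by
      have : ContinuousAt (fun x => (x, h x)) a := continuousAt_id.prodMk hcont
      simpa [ContinuousAt, hh] using this
    have ht' : Tendsto (fun x => (x, h' x)) (𝓝 a) (𝓝 (a, w')) := by
      have : ContinuousAt (fun x => (x, h' x)) a := continuousAt_id.prodMk hcont'
      simpa [ContinuousAt, hh'] using this
    have hmem : ∀ᶠ x in 𝓝 a, (x, (h x, h' x)) ∈ S := by
      have e1 : ∀ᶠ x in 𝓝 a, h x ∈ ball (0 : ℂ) ρ :=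
        hcont.eventually (isOpen_ball.mem_nhds (hh ▸ hzero a ha w hw h0))
      have e2 : ∀ᶠ x in 𝓝 a, h' x ∈ ball (0 : ℂ) ρ :=
        hcont'.eventually (isOpen_ball.mem_nhds (hh' ▸ hzero a ha w' hw' h0'))
      have e3 : ∀ᶠ x in 𝓝 a, h x ≠ h' x :=
        ((hcont.sub hcont').eventually_ne (by rwa [Pi.sub_apply, hh, hh', sub_ne_zero])).mono fun _ =>
          sub_ne_zero.1
      filter_upwards [e1, e2, e3, isOpen_ball.eventually_mem har, ht.eventually hev,
        ht'.eventually hev'] with x x1 x2 x3 x4 x5 x6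
      exact ⟨⟨ball_subset_closedBall x4, ball_subset_closedBall x1, ball_subset_closedBall x2⟩,
        ⟨x5.2 rfl, x6.2 rfl⟩, x3⟩
    have hloc : IsLocalMin (norm ∘ fun x => h x - h' x) a := by
      filter_upwards [hmem] with x hxm
      have := hymin hxm
      simp only [Function.comp_apply, hh, hh', ← dist_eq_norm]
      rw [hdist]
      exact this
    have hdiff : ∀ᶠ x in 𝓝 a, DifferentiableAt ℂ (fun x => h x - h' x) x := by
      filter_upwards [hd, hd'] with x hx hx' using hx.sub hx'
    rcases Complex.eventually_eq_or_eq_zero_of_isLocalMin_norm hdiff hloc with heq | h00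
    · filter_upwards [hmem, heq] with x x1 x2
      refine ⟨(x, (h x, h' x)), ⟨x1, ?_⟩, rfl⟩
      simp only [mem_ofPred_eq, dist_eq_norm, x2, hh, hh']
      rw [← dist_eq_norm, hdist]
    · rw [hh, hh', sub_eq_zero] at h00
      exact absurd h00 hww'
  rcases isClopen_iff.1 ⟨hAc.isClosed, hAo⟩ with h | h
  · exact (h ▸ (⟨y, ⟨hyS, rfl⟩, rfl⟩ : y.1 ∈ A) : y.1 ∈ (∅ : Set ℂ))
  · exact noncompact_univ ℂ (h ▸ hAc)

/-- A holomorphic function on the unit disc whose zeros stay in a smaller disc has isolated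
zeros. -/
theorem exists_pos_forall_ne_zero {f : ℂ → ℂ} {ρ : ℝ} (hρ : ρ < 1)
    (hf : DifferentiableOn ℂ f (ball 0 1))
    (hzero : ∀ w ∈ ball (0 : ℂ) 1, f w = 0 → w ∈ ball (0 : ℂ) ρ) {w : ℂ}
    (hw : w ∈ ball (0 : ℂ) 1) : ∃ δ > 0, ∀ z ∈ ball w δ, z ≠ w → f z ≠ 0 := by
  have han : AnalyticOnNhd ℂ f (ball 0 1) := hf.analyticOnNhd isOpen_ball
  rcases (han w hw).eventually_eq_zero_or_eventually_ne_zero with h | h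
  · exfalso
    have heq := han.eqOn_zero_of_preconnected_of_eventuallyEq_zero
      (convex_ball (0 : ℂ) 1).isPreconnected hw h
    have hmem : ((max ρ 0 : ℝ) : ℂ) ∈ ball (0 : ℂ) 1 := by
      rw [mem_ball_zero_iff, Complex.norm_real, Real.norm_of_nonneg (le_max_right _ _)]
      exact max_lt hρ one_pos
    have := hzero _ hmem (heq hmem)
    rw [mem_ball_zero_iff, Complex.norm_real, Real.norm_of_nonneg (le_max_right _ _)] at this
    exact absurd (le_max_left ρ 0) this.not_ge
  · rw [eventually_nhdsWithin_iff, Metric.eventually_nhds_iff_ball] at h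
    exact h

/-- Persistence of double zeros along a homotopy: if the zeros stay in a compact set and are
simple for parameters near the boundary of the disc, then the existence of a double zero does not
depend on the homotopy parameter. -/
theorem exists_double_zero_of_homotopy {Ψ : (ℂ × ℂ) × ℂ → ℂ} {U : Set ((ℂ × ℂ) × ℂ)}
    (hU : IsOpen U) (hΨ : DifferentiableOn ℂ Ψ U) {r ρ : ℝ} (hr : r < 1) (hρ : ρ < 1)
    (hsub : ∀ t ∈ Icc (0 : ℝ) 1, ∀ x ∈ ball (0 : ℂ) 1, ∀ w ∈ ball (0 : ℂ) 1,
      (((t : ℂ), x), w) ∈ U)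
    (hzero : ∀ t ∈ Icc (0 : ℝ) 1, ∀ x ∈ ball (0 : ℂ) 1, ∀ w ∈ ball (0 : ℂ) 1,
      Ψ (((t : ℂ), x), w) = 0 → w ∈ ball (0 : ℂ) ρ)
    (hsimple : ∀ t ∈ Icc (0 : ℝ) 1, ∀ x ∈ ball (0 : ℂ) 1, x ∉ ball (0 : ℂ) r →
      ∀ w ∈ ball (0 : ℂ) 1, Ψ (((t : ℂ), x), w) = 0 →
        deriv (fun z => Ψ (((t : ℂ), x), z)) w ≠ 0)
    (h1 : ∃ x ∈ ball (0 : ℂ) 1, ∃ w ∈ ball (0 : ℂ) 1,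
      Ψ ((((1 : ℝ) : ℂ), x), w) = 0 ∧ deriv (fun z => Ψ ((((1 : ℝ) : ℂ), x), z)) w = 0) :
    ∃ x ∈ ball (0 : ℂ) 1, ∃ w ∈ ball (0 : ℂ) 1,
      Ψ ((((0 : ℝ) : ℂ), x), w) = 0 ∧ deriv (fun z => Ψ ((((0 : ℝ) : ℂ), x), z)) w = 0 := by
  by_contra hgood
  have hrball : closedBall (0 : ℂ) r ⊆ ball 0 1 := closedBall_subset_ball hr
  have hρball : closedBall (0 : ℂ) ρ ⊆ ball 0 1 := closedBall_subset_ball hρ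
  set I : Set ℂ := Complex.ofReal '' Icc (0 : ℝ) 1 with hI
  have hIc : IsCompact I := isCompact_Icc.image Complex.continuous_ofReal
  set Z : Set ℝ := {t | t ∈ Icc (0 : ℝ) 1 ∧ ∃ x ∈ ball (0 : ℂ) 1, ∃ w ∈ ball (0 : ℂ) 1,
    Ψ (((t : ℂ), x), w) = 0 ∧ deriv (fun z => Ψ (((t : ℂ), x), z)) w = 0} with hZ
  have hZc : IsClosed Z := by
    have hK : IsCompact ((I ×ˢ closedBall (0 : ℂ) r) ×ˢ closedBall (0 : ℂ) ρ) :=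
      (hIc.prod (isCompact_closedBall _ _)).prod (isCompact_closedBall _ _)
    have hKU : (I ×ˢ closedBall (0 : ℂ) r) ×ˢ closedBall (0 : ℂ) ρ ⊆ U := by
      rintro ⟨⟨_, x⟩, w⟩ ⟨⟨⟨t, ht, rfl⟩, hx⟩, hw⟩
      exact hsub t ht x (hrball hx) w (hρball hw)
    have hC := ((hΨ.continuousOn.prodMk (continuousOn_deriv_snd hU hΨ)).mono
      hKU).preimage_isClosed_of_isClosed hK.isClosed
        (isClosed_singleton (x := ((0 : ℂ), (0 : ℂ))))
    have hCc := hK.of_isClosed_subset hC inter_subset_left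
    have himg := hCc.image (f := fun u : (ℂ × ℂ) × ℂ => u.1.1.re) (by fun_prop)
    convert himg.isClosed using 1
    ext t
    constructor
    · rintro ⟨ht, x, hx, w, hw, h0, hd⟩
      have hxr : x ∈ ball (0 : ℂ) r := by
        by_contra hnot
        exact hsimple t ht x hx hnot w hw h0 hd
      exact ⟨(((t : ℂ), x), w), ⟨⟨⟨⟨t, ht, rfl⟩, ball_subset_closedBall hxr⟩,
        ball_subset_closedBall (hzero t ht x hx w hw h0)⟩, by simp [h0, hd]⟩, by simp⟩
    · rintro ⟨⟨⟨_, x⟩, w⟩, ⟨⟨⟨⟨t, ht, rfl⟩, hx⟩, hw⟩, h0⟩, rfl⟩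
      simp only [mem_preimage, mem_singleton_iff, Prod.mk.injEq] at h0
      exact ⟨by simpa using ht, x, hrball hx, w, hρball hw, by simpa using h0⟩
  obtain ⟨s, hsI, hsZ, hsT⟩ := isPreconnected_closed_iff.1 (isPreconnected_Icc (a := (0 : ℝ))
    (b := 1)) Z (closure (Icc (0 : ℝ) 1 \ Z)) hZc isClosed_closure
    (fun t ht => by
      by_cases h : t ∈ Z
      · exact Or.inl h
      · exact Or.inr (subset_closure ⟨ht, h⟩))
    ⟨1, by simp, by simp, h1⟩ ⟨0, by simp, subset_closure ⟨by simp, fun h => hgood h.2⟩⟩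
  set T := Icc (0 : ℝ) 1 \ Z with hT
  obtain ⟨c₀, hc₀, hsep⟩ : ∃ c₀ > 0, ∀ t ∈ Icc (0 : ℝ) 1, ∀ x ∈ sphere (0 : ℂ) r,
      ∀ w₁ ∈ closedBall (0 : ℂ) ρ, ∀ w₂ ∈ closedBall (0 : ℂ) ρ, Ψ (((t : ℂ), x), w₁) = 0 →
      Ψ (((t : ℂ), x), w₂) = 0 → w₁ ≠ w₂ → c₀ ≤ dist w₁ w₂ := by
    have hS := isCompact_distinct_zeros hU hΨ (hIc.prod (isCompact_sphere (0 : ℂ) r))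
      (isCompact_closedBall (0 : ℂ) ρ) ?_ ?_
    · rcases Set.eq_empty_or_nonempty {x : (ℂ × ℂ) × (ℂ × ℂ) | (x.1 ∈ I ×ˢ sphere (0 : ℂ) r ∧
          x.2.1 ∈ closedBall (0 : ℂ) ρ ∧ x.2.2 ∈ closedBall (0 : ℂ) ρ) ∧
          (Ψ (x.1, x.2.1) = 0 ∧ Ψ (x.1, x.2.2) = 0) ∧ x.2.1 ≠ x.2.2} with he | he
      · refine ⟨1, one_pos, fun t ht x hx w₁ hw₁ w₂ hw₂ h₁ h₂ hne => ?_⟩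
        have : (((t : ℂ), x), (w₁, w₂)) ∈ (∅ : Set ((ℂ × ℂ) × (ℂ × ℂ))) :=
          he ▸ ⟨⟨⟨⟨t, ht, rfl⟩, hx⟩, hw₁, hw₂⟩, ⟨h₁, h₂⟩, hne⟩
        exact this.elim
      · obtain ⟨y, hyS, hymin⟩ := hS.exists_isMinOn he
          (f := fun y : (ℂ × ℂ) × (ℂ × ℂ) => dist y.2.1 y.2.2) (by fun_prop)
        refine ⟨_, dist_pos.2 hyS.2.2, fun t ht x hx w₁ hw₁ w₂ hw₂ h₁ h₂ hne => ?_⟩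
        exact hymin (a := (((t : ℂ), x), (w₁, w₂)))
          ⟨⟨⟨⟨t, ht, rfl⟩, hx⟩, hw₁, hw₂⟩, ⟨h₁, h₂⟩, hne⟩
    · rintro ⟨⟨_, x⟩, w⟩ ⟨⟨⟨t, ht, rfl⟩, hx⟩, hw⟩
      exact hsub t ht x (hrball (sphere_subset_closedBall hx)) w (hρball hw)
    · rintro ⟨_, x⟩ ⟨⟨t, ht, rfl⟩, hx⟩ w hw
      refine hsimple t ht x (hrball (sphere_subset_closedBall hx)) ?_ w (hρball hw)
      simp only [mem_ball, not_lt]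
      exact (mem_sphere.1 hx).ge
  have hsepT : ∀ t ∈ T, ∀ x ∈ closedBall (0 : ℂ) r, ∀ w₁ ∈ ball (0 : ℂ) 1,
      ∀ w₂ ∈ ball (0 : ℂ) 1, Ψ (((t : ℂ), x), w₁) = 0 → Ψ (((t : ℂ), x), w₂) = 0 → w₁ ≠ w₂ →
      c₀ ≤ dist w₁ w₂ := by
    intro t ht x hx w₁ hw₁ w₂ hw₂ h₁ h₂
    have hcont : Continuous fun v : ℂ × ℂ => (((t : ℂ), v.1), v.2) := by fun_prop
    refine le_dist_zeros_of_le_on_sphere (G := fun v : ℂ × ℂ => Ψ (((t : ℂ), v.1), v.2))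
      (hU.preimage hcont) (hΨ.comp (by fun_prop) fun v hv => hv)
      (fun v hv => hsub t ht.1 v.1 (hrball hv.1) v.2 (hρball hv.2))
      (fun x hx w hw h0 => hzero t ht.1 x (hrball hx) w (hρball hw) h0)
      (fun x hx w hw h0 hd => ht.2 ⟨ht.1, x, hrball hx, w, hρball hw, h0, hd⟩)
      (hsep t ht.1) x hx w₁ (ball_subset_closedBall (hzero t ht.1 x (hrball hx) w₁ hw₁ h₁)) w₂
      (ball_subset_closedBall (hzero t ht.1 x (hrball hx) w₂ hw₂ h₂)) h₁ h₂
  obtain ⟨-, x, hx, w, hw, h0, hd⟩ := hsZ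
  have hxr : x ∈ closedBall (0 : ℂ) r := by
    by_contra hnot
    exact hsimple s hsI x hx (fun h => hnot (ball_subset_closedBall h)) w hw h0 hd
  have hwρ := hzero s hsI x hx w hw h0
  have hfd : ∀ t ∈ Icc (0 : ℝ) 1,
      DifferentiableOn ℂ (fun z => Ψ (((t : ℂ), x), z)) (ball 0 1) := fun t ht =>
    hΨ.comp (by fun_prop) fun z hz => hsub t ht x hx z hz
  obtain ⟨δ, hδ, hδne⟩ := exists_pos_forall_ne_zero hρ (hfd s hsI) (hzero s hsI x hx) hw
  obtain ⟨σ, hσ, hσδ, hσc, hσρ⟩ : ∃ σ > 0, σ < δ ∧ 2 * σ < c₀ ∧ ρ + σ < 1 :=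
    ⟨min (δ / 2) (min (c₀ / 4) ((1 - ρ) / 2)), by
      have : 0 < 1 - ρ := by linarith
      positivity,
      by linarith [min_le_left (δ / 2) (min (c₀ / 4) ((1 - ρ) / 2))],
      by linarith [min_le_right (δ / 2) (min (c₀ / 4) ((1 - ρ) / 2)),
        min_le_left (c₀ / 4) ((1 - ρ) / 2)],
      by linarith [min_le_right (δ / 2) (min (c₀ / 4) ((1 - ρ) / 2)),
        min_le_right (c₀ / 4) ((1 - ρ) / 2)]⟩
  have hball : closedBall w σ ⊆ ball 0 1 := by
    refine closedBall_subset_ball' ?_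
    rw [mem_ball] at hwρ
    linarith
  have hcontAt : ∀ z ∈ ball (0 : ℂ) 1,
      ContinuousAt (fun q : ℝ × ℂ => Ψ (((q.1 : ℂ), x), q.2)) (s, z) := by
    intro z hz
    have h := hΨ.continuousOn.continuousAt (hU.mem_nhds (hsub s hsI x hx z hz))
    exact ContinuousAt.comp (f := fun q : ℝ × ℂ => (((q.1 : ℂ), x), q.2)) (x := (s, z)) h
      (by fun_prop)
  obtain ⟨m, hm, hmS⟩ : ∃ m > 0, ∀ z ∈ sphere w σ, m < ‖Ψ (((s : ℂ), x), z)‖ := by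
    obtain ⟨y, hy, hymin⟩ := (isCompact_sphere w σ).exists_isMinOn
      (NormedSpace.sphere_nonempty.2 hσ.le) (f := fun z => ‖Ψ (((s : ℂ), x), z)‖)
      ((hfd s hsI).continuousOn.norm.mono (sphere_subset_closedBall.trans hball))
    have hne : 0 < ‖Ψ (((s : ℂ), x), y)‖ := by
      refine norm_pos_iff.2 (hδne y ?_ (ne_of_mem_sphere hy hσ.ne'))
      rw [mem_ball, mem_sphere.1 hy]
      exact hσδ
    exact ⟨_, half_pos hne, fun z hz => (half_lt_self hne).trans_le (hymin hz)⟩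
  have hev : ∀ᶠ t : ℝ in 𝓝 s, ∀ z ∈ sphere w σ, m < ‖Ψ (((t : ℂ), x), z)‖ := by
    refine (isCompact_sphere w σ).eventually_forall_of_forall_eventually fun z hz => ?_
    exact (hcontAt z (hball (sphere_subset_closedBall hz))).norm.eventually
      (lt_mem_nhds (hmS z hz))
  have hlow : ∀ z ∈ closedBall w σ, m / (2 * σ) * ‖z - w‖ ≤ ‖Ψ (((s : ℂ), x), z)‖ := by
    intro z hz
    have htend : ∀ z ∈ closedBall w σ, Tendsto (fun t : ℝ => ‖Ψ (((t : ℂ), x), z)‖) (𝓝[T] s)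
        (𝓝 ‖Ψ (((s : ℂ), x), z)‖) := by
      intro z hz
      have h := (hcontAt z (hball hz)).norm
      exact (ContinuousAt.comp (f := fun t : ℝ => (t, z)) (x := s) h
        (by fun_prop)).tendsto.mono_left nhdsWithin_le_nhds
    have hlim := (htend z hz).add (htend w (mem_closedBall_self hσ.le))
    rw [h0, norm_zero, add_zero] at hlim
    have : (𝓝[T] s).NeBot := mem_closure_iff_nhdsWithin_neBot.1 hsT
    refine ge_of_tendsto hlim ?_
    filter_upwards [nhdsWithin_le_nhds hev, self_mem_nhdsWithin] with t ht htT
    refine norm_sub_le_of_unique_simple_zero isOpen_ball (hfd t htT.1) hσ hm hball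
      (fun z hz => (ht z hz).le) (fun z₁ hz₁ z₂ hz₂ h₁ h₂ => ?_) (fun z hz hz0 hzd => ?_) hz
      (mem_closedBall_self hσ.le)
    · by_contra hne
      have := hsepT t htT x hxr z₁ (hball hz₁) z₂ (hball hz₂) h₁ h₂ hne
      rw [mem_closedBall] at hz₁ hz₂
      linarith [dist_triangle_right z₁ z₂ w]
    · exact htT.2 ⟨htT.1, x, hx, z, hball hz, hz0, hzd⟩
  have hderiv : HasDerivAt (fun z => Ψ (((s : ℂ), x), z)) 0 w :=
    hd ▸ ((hfd s hsI).differentiableAt (isOpen_ball.mem_nhds hw)).hasDerivAt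
  have hpos : 0 < m / (2 * σ) / 2 := by positivity
  have hsmall := (hasDerivAt_iff_isLittleO.1 hderiv).def hpos
  obtain ⟨z, ⟨hz1, hz2⟩, hz3⟩ := (((hsmall.and
    (closedBall_mem_nhds w hσ)).filter_mono nhdsWithin_le_nhds).and
      (self_mem_nhdsWithin (s := {w}ᶜ))).exists
  have hzw : 0 < ‖z - w‖ := norm_pos_iff.2 (sub_ne_zero.2 hz3)
  simp only [h0, smul_zero, sub_zero] at hz1
  nlinarith [hlow z hz2, mul_pos hpos hzw]

/-- A holomorphic map from the unit disc into a smaller disc has derivative different from `1` at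
a fixed point. -/
theorem deriv_ne_one_of_fixed_point {f : ℂ → ℂ} {ρ : ℝ} (hρ : ρ < 1)
    (hf : DifferentiableOn ℂ f (ball 0 1)) (hmaps : MapsTo f (ball 0 1) (ball 0 ρ)) {w : ℂ}
    (hw : w ∈ ball (0 : ℂ) 1) (hfix : f w = w) : deriv f w ≠ 1 := by
  intro hd
  set η : ℝ := (1 - ρ) / 2 with hη
  have hηpos : 0 < η := by rw [hη]; linarith
  set F : ℂ → ℂ := fun z => f z + η * (f z - w) with hF
  have hFd : DifferentiableOn ℂ F (ball 0 1) := hf.add ((hf.sub_const w).const_mul (η : ℂ))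
  have hFmaps : MapsTo F (ball 0 1) (ball 0 1) := by
    intro z hz
    have h1 := hmaps hz
    rw [mem_ball_zero_iff] at h1 hw ⊢
    have h2 : ‖(η : ℂ) * (f z - w)‖ ≤ η * (ρ + 1) := by
      rw [norm_mul, Complex.norm_real, Real.norm_of_nonneg hηpos.le]
      exact mul_le_mul_of_nonneg_left ((norm_sub_le _ _).trans (by linarith)) hηpos.le
    calc ‖F z‖ ≤ ‖f z‖ + ‖(η : ℂ) * (f z - w)‖ := norm_add_le _ _
      _ < ρ + η * (ρ + 1) := by linarith
      _ ≤ 1 := by nlinarith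
  have hFfix : F w = w := by simp [hF, hfix]
  have hFder : HasDerivAt F (1 + η : ℂ) w := by
    have h := (hf.differentiableAt (isOpen_ball.mem_nhds hw)).hasDerivAt
    rw [hd] at h
    have h2 := h.fun_add ((h.sub_const w).const_mul (η : ℂ))
    rwa [mul_one] at h2
  have hR : 0 < 1 - ‖w‖ := by rw [mem_ball_zero_iff] at hw; linarith
  have hbound : ∀ n : ℕ, (1 + η) ^ n ≤ 2 / (1 - ‖w‖) := by
    intro n
    have hsub : ball w (1 - ‖w‖) ⊆ ball 0 1 := ball_subset_ball' (by simp)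
    have hit : HasDerivAt F^[n] ((1 + η : ℂ) ^ n) w := hFder.iterate w hFfix n
    have hitm := hFmaps.iterate n
    have h := Complex.norm_deriv_le_div_of_mapsTo_ball (f := F^[n]) (R₂ := 2)
      ((hFd.iterate hFmaps n).mono hsub) (fun z hz => ?_) hR
    · rw [hit.deriv, norm_pow] at h
      have : ‖(1 + η : ℂ)‖ = 1 + η := by
        rw [← Complex.ofReal_one, ← Complex.ofReal_add, Complex.norm_real,
          Real.norm_of_nonneg (by linarith)]
      rwa [this] at h
    · have h1 := hitm (hsub hz)
      have h2 := hitm hw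
      rw [mem_ball] at h1 h2
      rw [mem_closedBall]
      linarith [dist_triangle_right (F^[n] z) (F^[n] w) 0]
  obtain ⟨n, hn⟩ := pow_unbounded_of_one_lt (2 / (1 - ‖w‖)) (by linarith : 1 < 1 + η)
  exact absurd (hbound n) hn.not_ge

/-- A vertical graph is transverse to every horizontal graph. -/
theorem deriv_ne_zero_of_graph {G : ℂ × ℂ → ℂ} {h γ : ℂ → ℂ} {ρ : ℝ} (hρ : ρ < 1)
    (hG : DifferentiableOn ℂ G (ball 0 1 ×ˢ ball 0 1))
    (hh : DifferentiableOn ℂ h (ball 0 1)) (hhmaps : MapsTo h (ball 0 1) (ball 0 ρ))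
    (hγ : DifferentiableOn ℂ γ (ball 0 1)) (hγmaps : MapsTo γ (ball 0 1) (ball 0 1))
    (hGh : ∀ z ∈ ball (0 : ℂ) 1, G (z, h z) = 0) {w : ℂ} (hw : w ∈ ball (0 : ℂ) 1)
    (hwh : h (γ w) = w) (hgrad : fderiv ℂ G (γ w, w) ≠ 0) :
    deriv (fun w => G (γ w, w)) w ≠ 0 := by
  intro hd
  have hγw := hγmaps hw
  have hL : HasFDerivAt G (fderiv ℂ G (γ w, w)) (γ w, w) :=
    (hG.differentiableAt ((isOpen_ball.prod isOpen_ball).mem_nhds ⟨hγw, hw⟩)).hasFDerivAt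
  set L := fderiv ℂ G (γ w, w) with hLdef
  have hγd := (hγ.differentiableAt (isOpen_ball.mem_nhds hw)).hasDerivAt
  have hhd := (hh.differentiableAt (isOpen_ball.mem_nhds hγw)).hasDerivAt
  have hdec : ∀ a b : ℂ, L (a, b) = a * L (1, 0) + b * L (0, 1) := by
    intro a b
    have : ((a, b) : ℂ × ℂ) = a • ((1 : ℂ), (0 : ℂ)) + b • ((0 : ℂ), (1 : ℂ)) := by simp
    rw [this, map_add, map_smul, map_smul, smul_eq_mul, smul_eq_mul]
  have e1 : L (deriv γ w, 1) = 0 := by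
    have h1 : HasDerivAt (fun w => G (γ w, w)) (L (deriv γ w, 1)) w :=
      HasFDerivAt.comp_hasDerivAt w hL (hγd.prodMk (hasDerivAt_id w))
    rw [← hd, h1.deriv]
  have e2 : L (1, deriv h (γ w)) = 0 := by
    have h1 : HasDerivAt (fun z => G (z, h z)) (L (1, deriv h (γ w))) (γ w) :=
      HasFDerivAt.comp_hasDerivAt (γ w) (by rwa [hwh])
        ((hasDerivAt_id (γ w)).prodMk hhd)
    have h2 : (fun z => G (z, h z)) =ᶠ[𝓝 (γ w)] fun _ => 0 :=
      (isOpen_ball.eventually_mem hγw).mono hGh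
    exact h1.unique ((hasDerivAt_const (γ w) (0 : ℂ)).congr_of_eventuallyEq h2)
  have hcomp : deriv (h ∘ γ) w ≠ 1 :=
    deriv_ne_one_of_fixed_point hρ (hh.comp hγ hγmaps) (hhmaps.comp hγmaps) hw hwh
  rw [(hhd.comp w hγd).deriv] at hcomp
  rw [hdec] at e1 e2
  have hB : L (0, 1) = 0 := by
    have : L (0, 1) * (1 - deriv h (γ w) * deriv γ w) = 0 := by
      linear_combination e1 - deriv γ w * e2
    exact (mul_eq_zero.1 this).resolve_right (sub_ne_zero.2 hcomp.symm)
  have hA : L (1, 0) = 0 := by rw [hB] at e2; simpa using e2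
  refine hgrad (ContinuousLinearMap.ext fun v => ?_)
  rw [← Prod.mk.eta (p := v), hdec, hA, hB]
  simp

/-- A curve in the bidisc, proper over the first factor and without vertical tangents, is a finite
union of graphs. -/
theorem exists_graphs_of_proper {G : ℂ × ℂ → ℂ}
    (hG : DifferentiableOn ℂ G (ball 0 1 ×ˢ ball 0 1)) {V : Set (ℂ × ℂ)}
    (hV : V = {p ∈ ball (0 : ℂ) 1 ×ˢ ball (0 : ℂ) 1 | G p = 0})
    (hproper : ∀ K, K ⊆ ball (0 : ℂ) 1 → IsCompact K → IsCompact {p ∈ V | p.1 ∈ K})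
    (hsimple : ∀ p ∈ V, deriv (fun w => G (p.1, w)) p.2 ≠ 0) :
    ∃ (m : ℕ) (h : Fin m → ℂ → ℂ),
      (∀ i, DifferentiableOn ℂ (h i) (ball 0 1)) ∧
      (∀ i, ∀ z ∈ ball (0 : ℂ) 1, h i z ∈ ball (0 : ℂ) 1) ∧
      V = ⋃ i, (fun z => (z, h i z)) '' ball (0 : ℂ) 1 := by
  have hU : IsOpen (ball (0 : ℂ) 1 ×ˢ ball (0 : ℂ) 1) := isOpen_ball.prod isOpen_ball
  have hVB : ∀ p ∈ V, p ∈ ball (0 : ℂ) 1 ×ˢ ball (0 : ℂ) 1 := fun p hp => (hV ▸ hp).1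
  have hV0 : ∀ p ∈ V, G p = 0 := fun p hp => (hV ▸ hp).2
  have hVmem : ∀ p ∈ ball (0 : ℂ) 1 ×ˢ ball (0 : ℂ) 1, G p = 0 → p ∈ V :=
    fun p hp h0 => hV ▸ ⟨hp, h0⟩
  have himp := fun p (hp : p ∈ V) =>
    exists_implicit_function_eventually hU hG (hVB p hp) (hV0 p hp) (hsimple p hp)
  set π : V → ball (0 : ℂ) 1 := fun e => ⟨e.1.1, (hVB e.1 e.2).1⟩ with hπ
  have hπc : Continuous π := by fun_prop
  have hopen : IsOpenMap π := by
    rw [isOpenMap_iff_nhds_le]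
    intro e s hs
    rw [mem_map] at hs
    obtain ⟨u, hu, hus⟩ := mem_nhds_subtype _ _ _ |>.1 hs
    obtain ⟨h, hd, hhe, hev⟩ := himp e.1 e.2
    have ht : Tendsto (fun x => (x, h x)) (𝓝 e.1.1) (𝓝 e.1) := by
      have : ContinuousAt (fun x => (x, h x)) e.1.1 :=
        continuousAt_id.prodMk hd.self_of_nhds.continuousAt
      simpa [ContinuousAt, hhe] using this
    have hnear : ∀ᶠ x in 𝓝 e.1.1, (x, h x) ∈ u ∧ (x, h x) ∈ V := by
      filter_upwards [ht.eventually hu, ht.eventually (hU.eventually_mem (hVB _ e.2)),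
        ht.eventually hev] with x h1 h2 h3
      exact ⟨h1, hVmem _ h2 (h3.2 rfl)⟩
    have hnear' : ∀ᶠ x : ball (0 : ℂ) 1 in 𝓝 (π e), ((x : ℂ), h x) ∈ u ∧ ((x : ℂ), h x) ∈ V :=
      (continuous_subtype_val.tendsto (π e)).eventually hnear
    filter_upwards [hnear'] with x hx
    exact hus (show (⟨_, hx.2⟩ : V) ∈ Subtype.val ⁻¹' u from hx.1)
  have hloc : IsLocalHomeomorph π := by
    rw [isLocalHomeomorph_iff_isOpenEmbedding_restrict]
    intro e
    obtain ⟨h, hd, hhe, hev⟩ := himp e.1 e.2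
    obtain ⟨N, hN, hNo, heN⟩ := _root_.eventually_nhds_iff.1 hev
    have hO : IsOpen (Subtype.val ⁻¹' N : Set V) := hNo.preimage continuous_subtype_val
    refine ⟨Subtype.val ⁻¹' N, hO.mem_nhds heN, .of_continuous_injective_isOpenMap
      (hπc.comp continuous_subtype_val) ?_ (hopen.domRestrict hO)⟩
    rintro ⟨a, ha⟩ ⟨b, hb⟩ hab
    have h1 : a.1.1 = b.1.1 := congrArg Subtype.val hab
    have h2 := (hN _ ha).1 (hV0 _ a.2)
    have h3 := (hN _ hb).1 (hV0 _ b.2)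
    exact Subtype.ext (Subtype.ext (Prod.ext h1 (by rw [← h2, ← h3, h1])))
  have hprop : IsProperMap π := by
    rw [isProperMap_iff_isCompact_preimage]
    refine ⟨hπc, fun K hK => ?_⟩
    rw [Topology.IsEmbedding.subtypeVal.isCompact_iff]
    convert hproper (Subtype.val '' K) (by rintro _ ⟨x, -, rfl⟩; exact x.2)
      (hK.image continuous_subtype_val) using 1
    ext p
    constructor
    · rintro ⟨e, he, rfl⟩
      exact ⟨e.2, π e, he, rfl⟩
    · rintro ⟨hp, x, hx, hxp⟩
      refine ⟨⟨p, hp⟩, ?_, rfl⟩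
      have : π ⟨p, hp⟩ = x := Subtype.ext hxp.symm
      rwa [mem_preimage, this]
  have hfin : ∀ x, (π ⁻¹' {x}).Finite := fun x =>
    (hprop.isCompact_preimage isCompact_singleton).finite
      ((hloc.isLocalHomeomorphOn.mono (subset_univ _)).isDiscrete_of_image
        ((subsingleton_singleton.anti (image_preimage_subset _ _)).isDiscrete))
  have hcov : IsCoveringMap π := by
    rw [isCoveringMap_iff_isCoveringMapOn_univ]
    exact hprop.isClosedMap.isCoveringMapOn_of_isLocalHomeomorphOn (fun x _ => hfin x)
      hloc.isLocalHomeomorphOn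
  have : ContractibleSpace (ball (0 : ℂ) 1) := contractibleSpace_ball one_pos
  have : LocallyPathConnectedSpace (ball (0 : ℂ) 1) := isOpen_ball.locallyPathConnectedSpace
  have hlift := fun e : V => hcov.existsUnique_continuousMap_lifts
    (ContinuousMap.id (ball (0 : ℂ) 1)) (π e) e rfl
  choose σ hσ hσu using hlift
  have hσp : ∀ e x, (σ e x).1.1 = x := fun e x => congrArg Subtype.val (congrFun (hσ e).2 x)
  set o : ball (0 : ℂ) 1 := ⟨0, by simp⟩ with ho
  have := (hfin o).to_subtype
  obtain ⟨m, ⟨ι⟩⟩ := Finite.exists_equiv_fin (π ⁻¹' {o})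
  classical
  set k : Fin m → ℂ → ℂ := fun i z =>
    if hz : z ∈ ball (0 : ℂ) 1 then (σ (ι.symm i) ⟨z, hz⟩).1.2 else 0 with hk
  have hkval : ∀ i (x : ball (0 : ℂ) 1), ((x : ℂ), k i x) = (σ (ι.symm i) x).1 := by
    intro i x
    refine Prod.ext (hσp _ _).symm ?_
    simp only [hk]
    rw [dif_pos x.2]
  have hkV : ∀ i, ∀ z ∈ ball (0 : ℂ) 1, (z, k i z) ∈ V := by
    intro i z hz
    rw [hkval i ⟨z, hz⟩]
    exact (σ (ι.symm i) ⟨z, hz⟩).2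
  refine ⟨m, k, fun i z hz => ?_, fun i z hz => (hVB _ (hkV i z hz)).2, ?_⟩
  · have hcont : ContinuousOn (fun z => (z, k i z)) (ball (0 : ℂ) 1) := by
      rw [continuousOn_iff_continuous_domRestrict]
      have : (ball (0 : ℂ) 1).domRestrict (fun z => (z, k i z)) =
          fun x => (σ (ι.symm i) x).1 := funext fun x => hkval i x
      rw [this]
      fun_prop
    obtain ⟨h, hd, -, hev⟩ := himp _ (hkV i z hz)
    refine (hd.self_of_nhds.congr_of_eventuallyEq ?_).differentiableWithinAt
    filter_upwards [(hcont.continuousAt (isOpen_ball.mem_nhds hz)).eventually hev,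
      isOpen_ball.eventually_mem hz] with x h1 h2
    exact (h1.1 (hV0 _ (hkV i x h2))).symm
  · ext p
    rw [mem_iUnion]
    constructor
    · intro hp
      set e : V := ⟨p, hp⟩ with he
      have hmem : σ e o ∈ π ⁻¹' {o} := congrFun (hσ e).2 o
      have heq : σ e = σ (σ e o) :=
        hσu (σ e o) (σ e) ⟨by rw [show π (σ e o) = o from hmem], (hσ e).2⟩
      refine ⟨ι ⟨σ e o, hmem⟩, p.1, (hVB p hp).1, ?_⟩
      have h1 := hkval (ι ⟨σ e o, hmem⟩) (π e)
      rw [ι.symm_apply_apply, ← heq, (hσ e).1] at h1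
      exact h1
    · rintro ⟨i, z, hz, rfl⟩
      exact hkV i z hz

/-- **Proposition (creating tangencies between horizontal and vertical moving curves).**
Let `(V_λ)` be a holomorphic family of horizontal submanifolds of degree `k` in the
bidisk `𝔹 = 𝔻 × 𝔻`, cut out by a holomorphic function `F` with nonvanishing gradient
along `V_λ`. If `V_λ` is a union of `k` disjoint horizontal graphs for `λ` outside a
compact set `Λ₀`, but `V_{λ₀}` is not a union of horizontal graphs for some `λ₀`, then
for any holomorphic family `(W_λ)` of vertical graphs there is a parameter `λ₁` at which
`V_{λ₁}` and `W_{λ₁}` are tangent: `w ↦ F(λ₁, (g(λ₁,w), w))` has a zero of multiplicity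
at least two. -/
theorem tangency_between_horizontal_and_vertical
    (k : ℕ) (hk : 1 ≤ k)
    (F : ℂ → ℂ × ℂ → ℂ) (ε : ℝ) (hε : 0 < ε)
    (hFhol : DifferentiableOn ℂ (fun p : ℂ × (ℂ × ℂ) => F p.1 p.2)
      (Metric.ball 0 1 ×ˢ (Metric.ball (0 : ℂ) 1 ×ˢ Metric.ball (0 : ℂ) 1)))
    (V : ℂ → Set (ℂ × ℂ))
    (hV : ∀ μ ∈ Metric.ball (0 : ℂ) 1,
      V μ = {p ∈ Metric.ball (0 : ℂ) 1 ×ˢ Metric.ball (0 : ℂ) 1 | F μ p = 0})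
    (hVne : ∀ μ ∈ Metric.ball (0 : ℂ) 1, (V μ).Nonempty)
    (hgrad : ∀ μ ∈ Metric.ball (0 : ℂ) 1, ∀ p ∈ V μ, fderiv ℂ (F μ) p ≠ 0)
    (hhoriz : ∀ μ ∈ Metric.ball (0 : ℂ) 1, ∀ p ∈ V μ, p.2 ∈ Metric.ball (0 : ℂ) (1 - ε))
    (hproper : ∀ μ ∈ Metric.ball (0 : ℂ) 1, ∀ K, K ⊆ Metric.ball (0 : ℂ) 1 →
      IsCompact K → IsCompact {p ∈ V μ | p.1 ∈ K})
    (hdeg : ∀ μ ∈ Metric.ball (0 : ℂ) 1, ∃ S : Set ℂ, S.Finite ∧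
      ∀ z ∈ Metric.ball (0 : ℂ) 1 \ S, {p ∈ V μ | p.1 = z}.ncard = k)
    (Λ₀ : Set ℂ) (hΛ₀cpt : IsCompact Λ₀) (hΛ₀sub : Λ₀ ⊆ Metric.ball 0 1)
    (hout : ∀ μ ∈ Metric.ball (0 : ℂ) 1 \ Λ₀,
      ∃ h : Fin k → ℂ → ℂ,
        (∀ i, DifferentiableOn ℂ (h i) (Metric.ball 0 1)) ∧
        (∀ i, ∀ z ∈ Metric.ball (0 : ℂ) 1, h i z ∈ Metric.ball (0 : ℂ) 1) ∧
        (∀ i j, i ≠ j → ∀ z ∈ Metric.ball (0 : ℂ) 1, h i z ≠ h j z) ∧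
        V μ = ⋃ i, (fun z => (z, h i z)) '' Metric.ball (0 : ℂ) 1)
    (μ₀ : ℂ) (hμ₀ : μ₀ ∈ Metric.ball (0 : ℂ) 1)
    (hnotgraphs : ¬ ∃ (m : ℕ) (h : Fin m → ℂ → ℂ),
        (∀ i, DifferentiableOn ℂ (h i) (Metric.ball 0 1)) ∧
        (∀ i, ∀ z ∈ Metric.ball (0 : ℂ) 1, h i z ∈ Metric.ball (0 : ℂ) 1) ∧
        V μ₀ = ⋃ i, (fun z => (z, h i z)) '' Metric.ball (0 : ℂ) 1)
    (g : ℂ → ℂ → ℂ)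
    (hghol : DifferentiableOn ℂ (fun p : ℂ × ℂ => g p.1 p.2)
      (Metric.ball 0 1 ×ˢ Metric.ball (0 : ℂ) 1))
    (hgmap : ∀ μ ∈ Metric.ball (0 : ℂ) 1, ∀ w ∈ Metric.ball (0 : ℂ) 1,
      g μ w ∈ Metric.ball (0 : ℂ) 1) :
    ∃ μ₁ ∈ Metric.ball (0 : ℂ) 1, ∃ w₀ ∈ Metric.ball (0 : ℂ) 1,
      F μ₁ (g μ₁ w₀, w₀) = 0 ∧ deriv (fun w => F μ₁ (g μ₁ w, w)) w₀ = 0 := by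
  set D : Set ℂ := ball (0 : ℂ) 1 with hD
  have hFslice : ∀ μ ∈ D, DifferentiableOn ℂ (F μ) (D ×ˢ D) := fun μ hμ =>
    hFhol.comp (f := fun p : ℂ × ℂ => (μ, p)) (by fun_prop) fun p hp => ⟨hμ, hp⟩
  have hmemV : ∀ μ ∈ D, ∀ p, p ∈ V μ ↔ p ∈ D ×ˢ D ∧ F μ p = 0 := fun μ hμ p => by
    rw [hV μ hμ]; rfl
  obtain ⟨⟨z₀, w₀⟩, hp, hd⟩ : ∃ p ∈ V μ₀, deriv (fun w => F μ₀ (p.1, w)) p.2 = 0 := by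
    by_contra! hne
    exact hnotgraphs (exists_graphs_of_proper (hFslice μ₀ hμ₀) (hV μ₀ hμ₀) (hproper μ₀ hμ₀) hne)
  obtain ⟨⟨hz₀, hw₀⟩, hp0⟩ := (hmemV μ₀ hμ₀ _).1 hp
  obtain ⟨r, hr, hΛr⟩ : ∃ r < 1, Λ₀ ⊆ ball (0 : ℂ) r :=
    exists_lt_subset_ball hΛ₀cpt.isClosed hΛ₀sub
  let c : (ℂ × ℂ) × ℂ → ℂ := fun u => (1 - u.1.1) * g u.1.2 u.2 + u.1.1 * z₀
  let Ψ : (ℂ × ℂ) × ℂ → ℂ := fun u => F u.1.2 (c u, u.2)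
  let U₀ : Set ((ℂ × ℂ) × ℂ) := {u | u.1.2 ∈ D ∧ u.2 ∈ D}
  have hU₀ : IsOpen U₀ := (isOpen_ball.preimage (continuous_snd.comp continuous_fst)).inter
    (isOpen_ball.preimage continuous_snd)
  have hg₀ : DifferentiableOn ℂ (fun u : (ℂ × ℂ) × ℂ => g u.1.2 u.2) U₀ :=
    hghol.comp (f := fun u : (ℂ × ℂ) × ℂ => (u.1.2, u.2)) (by fun_prop) fun u hu => hu
  have hc : DifferentiableOn ℂ c U₀ :=
    (DifferentiableOn.mul (by fun_prop) hg₀).add (by fun_prop)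
  have hU : IsOpen (U₀ ∩ c ⁻¹' D) := hc.continuousOn.isOpen_inter_preimage hU₀ isOpen_ball
  have hΨ : DifferentiableOn ℂ Ψ (U₀ ∩ c ⁻¹' D) := by
    have hc' := hc.mono (inter_subset_left (t := c ⁻¹' D))
    exact hFhol.comp (f := fun u : (ℂ × ℂ) × ℂ => (u.1.2, (c u, u.2))) (by fun_prop)
      fun u hu => ⟨hu.1.1, hu.2, hu.1.2⟩
  have hcD : ∀ t ∈ Icc (0 : ℝ) 1, ∀ x ∈ D, ∀ w ∈ D, c (((t : ℂ), x), w) ∈ D := by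
    intro t ht x hx w hw
    have := (convex_ball (0 : ℂ) 1) (hgmap x hx w hw) hz₀ (sub_nonneg.2 ht.2) ht.1 (by ring)
    simpa [hD, c, Complex.real_smul] using this
  have hΨV : ∀ t ∈ Icc (0 : ℝ) 1, ∀ x ∈ D, ∀ w ∈ D, Ψ (((t : ℂ), x), w) = 0 →
      (c (((t : ℂ), x), w), w) ∈ V x := fun t ht x hx w hw h0 =>
    (hmemV x hx _).2 ⟨⟨hcD t ht x hx w hw, hw⟩, h0⟩
  have hρ : 1 - ε < 1 := by linarith
  have := exists_double_zero_of_homotopy hU hΨ hr hρ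
    (fun t ht x hx w hw => ⟨⟨hx, hw⟩, hcD t ht x hx w hw⟩)
    (fun t ht x hx w hw h0 => hhoriz x hx _ (hΨV t ht x hx w hw h0))
    (fun t ht x hx hxr w hw h0 => ?_)
    ⟨μ₀, hμ₀, w₀, hw₀, by simpa [Ψ, c] using hp0, by simpa [Ψ, c] using hd⟩
  · simpa [hD, Ψ, c] using this
  · have hwV := hΨV t ht x hx w hw h0
    obtain ⟨h, hhd, -, -, hVh⟩ := hout x ⟨hx, fun hxΛ => hxr (hΛr hxΛ)⟩
    have hhV : ∀ i, ∀ z ∈ D, (z, h i z) ∈ V x := fun i z hz =>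
      hVh ▸ mem_iUnion.2 ⟨i, z, hz, rfl⟩
    obtain ⟨i, z, -, hzw⟩ := mem_iUnion.1 (hVh ▸ hwV)
    obtain ⟨rfl, hiw⟩ := Prod.mk.inj hzw
    refine deriv_ne_zero_of_graph (γ := fun w => c (((t : ℂ), x), w)) hρ (hFslice x hx) (hhd i)
      (fun z hz => hhoriz x hx _ (hhV i z hz)) ?_ (fun w hw => hcD t ht x hx w hw)
      (fun z hz => ((hmemV x hx _).1 (hhV i z hz)).2) hw hiw (hgrad x hx _ hwV)
    exact hc.comp (f := fun w : ℂ => (((t : ℂ), x), w)) (by fun_prop) fun w hw => ⟨hx, hw⟩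
end

section
/- Let 𝒢 be a normal set of graphs such that 𝒢̄ is unbranched at λ₀ = 0. Then for each λ ∈ 𝔻 the map h_λ : 𝒢̄_0 → 𝒢̄_λ defined by h_λ(γ(0)) = γ(λ) for γ ∈ 𝒢̄ is well defined and continuous, and for each fixed z ∈ 𝒢̄_0 the map λ 'h_λ(z)' is holomorphic on 𝔻. -/
open Filter Metric Set

/-- A family of graphs `γ : 𝔻 → ℂ²` is normal if every sequence has a subsequence
either converging locally uniformly on `𝔻` to a holomorphic map, or tending to infinity
uniformly on compact subsets of `𝔻`. -/
def IsNormalGraphFamily (G : Set (ℂ → ℂ × ℂ)) : Prop :=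
  ∀ g : ℕ → ℂ → ℂ × ℂ, (∀ n, g n ∈ G) →
    ∃ φ : ℕ → ℕ, StrictMono φ ∧
      ((∃ γ : ℂ → ℂ × ℂ, DifferentiableOn ℂ γ (Metric.ball 0 1) ∧
          TendstoLocallyUniformlyOn (fun j => g (φ j)) γ atTop (Metric.ball 0 1)) ∨
        (∀ K, K ⊆ Metric.ball (0 : ℂ) 1 → IsCompact K → ∀ C : ℝ,
          ∀ᶠ j in atTop, ∀ z ∈ K, C ≤ ‖g (φ j) z‖))

/-- The closure `𝒢̄` of a family of graphs: all holomorphic maps on `𝔻` that are locally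
uniform limits of sequences in `𝒢`. -/
def GraphClosure (G : Set (ℂ → ℂ × ℂ)) : Set (ℂ → ℂ × ℂ) :=
  {γ | DifferentiableOn ℂ γ (Metric.ball 0 1) ∧
    ∃ g : ℕ → ℂ → ℂ × ℂ, (∀ n, g n ∈ G) ∧
      TendstoLocallyUniformlyOn g γ atTop (Metric.ball 0 1)}

lemma GraphClosure.exists_dist_lt {G : Set (ℂ → ℂ × ℂ)} {γ : ℂ → ℂ × ℂ}
    (hγ : γ ∈ GraphClosure G) {lam mu : ℂ} (hlam : lam ∈ ball (0 : ℂ) 1)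
    (hmu : mu ∈ ball (0 : ℂ) 1) {ε : ℝ} (hε : 0 < ε) :
    ∃ g ∈ G, dist (g lam) (γ lam) < ε ∧ dist (g mu) (γ mu) < ε := by
  obtain ⟨-, g, hg, hlim⟩ := hγ
  obtain ⟨n, hn⟩ := ((Metric.tendsto_nhds.1 (hlim.tendsto_at hlam) ε hε).and
    (Metric.tendsto_nhds.1 (hlim.tendsto_at hmu) ε hε)).exists
  exact ⟨g n, hg n, hn⟩

lemma GraphClosure.exists_subseq_tendsto {G : Set (ℂ → ℂ × ℂ)} (hG : IsNormalGraphFamily G)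
    (hunbr : ∀ γ ∈ GraphClosure G, ∀ γ' ∈ GraphClosure G, γ 0 = γ' 0 → EqOn γ γ' (ball 0 1))
    {u : ℕ → ℂ → ℂ × ℂ} (hu : ∀ n, u n ∈ GraphClosure G) {γ : ℂ → ℂ × ℂ}
    (hγ : γ ∈ GraphClosure G) (h0 : Tendsto (fun n => u n 0) atTop (nhds (γ 0)))
    {lam : ℂ} (hlam : lam ∈ ball (0 : ℂ) 1) :
    ∃ φ : ℕ → ℕ, StrictMono φ ∧ Tendsto (fun n => u (φ n) lam) atTop (nhds (γ lam)) := by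
  have hz : (0 : ℂ) ∈ ball (0 : ℂ) 1 := mem_ball_self one_pos
  choose g hgG hg0 hglam using fun n : ℕ =>
    GraphClosure.exists_dist_lt (hu n) hz hlam (Nat.one_div_pos_of_nat (α := ℝ) (n := n))
  have hd0 : Tendsto (fun n => dist (u n 0) (g n 0)) atTop (nhds 0) :=
    squeeze_zero (fun _ => dist_nonneg) (fun n => (dist_comm _ _).trans_le (hg0 n).le)
      tendsto_one_div_add_atTop_nhds_zero_nat
  have hdlam : Tendsto (fun n => dist (g n lam) (u n lam)) atTop (nhds 0) :=
    squeeze_zero (fun _ => dist_nonneg) (fun n => (hglam n).le)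
      tendsto_one_div_add_atTop_nhds_zero_nat
  have hg0lim : Tendsto (fun n => g n 0) atTop (nhds (γ 0)) := h0.congr_dist hd0
  obtain ⟨φ, hφ, ⟨γ', hγ', hlim⟩ | hinf⟩ := hG g hgG
  · refine ⟨φ, hφ, ?_⟩
    have h0' : γ 0 = γ' 0 :=
      tendsto_nhds_unique (hg0lim.comp hφ.tendsto_atTop) (hlim.tendsto_at hz)
    rw [hunbr γ hγ γ' ⟨hγ', _, fun n => hgG (φ n), hlim⟩ h0' hlam]
    exact (hlim.tendsto_at hlam).congr_dist (hdlam.comp hφ.tendsto_atTop)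
  · have hlt : ∀ᶠ j in atTop, ‖g (φ j) 0‖ < ‖γ 0‖ + 1 :=
      (hg0lim.comp hφ.tendsto_atTop).norm.eventually_lt_const (lt_add_one _)
    obtain ⟨j, hj, hj'⟩ := (hlt.and (hinf {0} (singleton_subset_iff.2 hz)
      isCompact_singleton (‖γ 0‖ + 1))).exists
    exact absurd hj (hj' 0 rfl).not_gt

/-- **Lemma.** Let `𝒢` be a normal family of graphs such that `𝒢̄` is unbranched at
`λ₀ = 0` (the evaluation `γ ↦ γ(0)` is injective on `𝒢̄`). Then the maps
`h_λ : 𝒢̄_0 → 𝒢̄_λ`, `γ(0) ↦ γ(λ)`, are well defined and continuous, and for each fixed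
`z ∈ 𝒢̄_0` the map `λ ↦ h_λ(z)` is holomorphic on `𝔻`. -/
theorem motion_welldefined_continuous_holomorphic
    (G : Set (ℂ → ℂ × ℂ))
    (hGhol : ∀ γ ∈ G, DifferentiableOn ℂ γ (Metric.ball 0 1))
    (hGnormal : IsNormalGraphFamily G)
    (hunbr : ∀ γ ∈ GraphClosure G, ∀ γ' ∈ GraphClosure G,
      γ 0 = γ' 0 → Set.EqOn γ γ' (Metric.ball 0 1)) :
    ∃ h : ℂ → ℂ × ℂ → ℂ × ℂ,
      (∀ lam ∈ Metric.ball (0 : ℂ) 1, ∀ γ ∈ GraphClosure G, h lam (γ 0) = γ lam) ∧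
      (∀ lam ∈ Metric.ball (0 : ℂ) 1,
        Set.MapsTo (h lam) ((fun γ => γ 0) '' GraphClosure G)
          ((fun γ => γ lam) '' GraphClosure G)) ∧
      (∀ lam ∈ Metric.ball (0 : ℂ) 1,
        ContinuousOn (h lam) ((fun γ => γ 0) '' GraphClosure G)) ∧
      (∀ z ∈ (fun γ => γ 0) '' GraphClosure G,
        DifferentiableOn ℂ (fun lam => h lam z) (Metric.ball 0 1)) := by
  classical
  let h : ℂ → ℂ × ℂ → ℂ × ℂ := fun lam z =>
    if hz : ∃ γ ∈ GraphClosure G, γ 0 = z then hz.choose lam else 0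
  have hh : ∀ lam ∈ ball (0 : ℂ) 1, ∀ γ ∈ GraphClosure G, h lam (γ 0) = γ lam := by
    intro lam hlam γ hγ
    have hz : ∃ γ' ∈ GraphClosure G, γ' 0 = γ 0 := ⟨γ, hγ, rfl⟩
    simp only [h, dif_pos hz]
    exact hunbr _ hz.choose_spec.1 _ hγ hz.choose_spec.2 hlam
  refine ⟨h, hh, ?_, ?_, ?_⟩
  · rintro lam hlam _ ⟨γ, hγ, rfl⟩
    exact ⟨γ, hγ, (hh lam hlam γ hγ).symm⟩
  · rintro lam hlam _ ⟨γ, hγ, rfl⟩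
    rw [ContinuousWithinAt, tendsto_nhdsWithin_iff_subtype (mem_image_of_mem (fun γ => γ 0) hγ)]
    refine tendsto_of_seq_tendsto fun x hx => tendsto_of_subseq_tendsto fun ns hns => ?_
    choose u hu hux using fun n => (x (ns n)).2
    have h0 : Tendsto (fun n => u n 0) atTop (nhds (γ 0)) := by
      simpa only [hux, Function.comp_def] using (continuous_subtype_val.tendsto _).comp (hx.comp hns)
    obtain ⟨φ, -, hlim⟩ := GraphClosure.exists_subseq_tendsto hGnormal hunbr hu hγ h0 hlam
    refine ⟨φ, ?_⟩
    rw [hh lam hlam γ hγ]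
    refine hlim.congr fun n => ?_
    rw [← hh lam hlam _ (hu (φ n))]
    exact congrArg (h lam) (hux (φ n))
  · rintro _ ⟨γ, hγ, rfl⟩
    exact hγ.1.congr fun lam hlam => hh lam hlam γ hγ
end

section
/- Let 𝒢 be a normal set of graphs such that 𝒢̄ is unbranched at every λ ∈ 𝔻. Then for every λ ∈ 𝔻 the map h_λ : 𝒢̄_0 → 𝒢̄_λ defined by h_λ(γ(0)) = γ(λ) for γ ∈ 𝒢̄ is a well-defined homeomorphism (a continuous bijection with continuous inverse). -/
open Filter Metric Set

/-- Along a sequence in `𝒢̄`, convergence at a parameter `a` to the value of some `γ ∈ 𝒢̄` that is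
determined by that value propagates to every other parameter `b`. -/
lemma tendsto_eval_of_tendsto_eval {G : Set (ℂ → ℂ × ℂ)} (hG : IsNormalGraphFamily G)
    {a b : ℂ} (ha : a ∈ ball (0 : ℂ) 1) (hb : b ∈ ball (0 : ℂ) 1)
    {γ : ℂ → ℂ × ℂ}
    (hunbr : ∀ γ' ∈ GraphClosure G, γ' a = γ a → EqOn γ' γ (ball 0 1))
    {u : ℕ → ℂ → ℂ × ℂ} (hu : ∀ n, u n ∈ GraphClosure G)
    (hlim : Tendsto (fun n => u n a) atTop (nhds (γ a))) :
    Tendsto (fun n => u n b) atTop (nhds (γ b)) := by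
  have happrox : ∀ n : ℕ, ∃ g ∈ G, dist (u n a) (g a) < 1 / ((n : ℝ) + 1) ∧
      dist (u n b) (g b) < 1 / ((n : ℝ) + 1) := by
    intro n
    obtain ⟨-, g, hgG, hg⟩ := hu n
    have hpos : 0 < 1 / ((n : ℝ) + 1) := Nat.one_div_pos_of_nat
    obtain ⟨k, hka, hkb⟩ :=
      ((Metric.tendsto_nhds.1 (hg.tendsto_at ha) _ hpos).and
        (Metric.tendsto_nhds.1 (hg.tendsto_at hb) _ hpos)).exists
    exact ⟨g k, hgG k, by rwa [dist_comm], by rwa [dist_comm]⟩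
  choose g hgG hga hgb using happrox
  have hdist : ∀ c, (∀ n : ℕ, dist (u n c) (g n c) < 1 / ((n : ℝ) + 1)) →
      Tendsto (fun n => dist (u n c) (g n c)) atTop (nhds 0) := fun c hc =>
    squeeze_zero (fun _ => dist_nonneg) (fun n => (hc n).le) tendsto_one_div_add_atTop_nhds_zero_nat
  have hglim : Tendsto (fun n => g n a) atTop (nhds (γ a)) :=
    (tendsto_iff_of_dist (hdist a hga)).1 hlim
  refine (tendsto_iff_of_dist (hdist b hgb)).2 (tendsto_of_subseq_tendsto fun ns hns => ?_)
  obtain ⟨φ, hφ, ⟨γ', hγ', hconv⟩ | hinf⟩ := hG (fun n => g (ns n)) fun n => hgG _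
  · have hmem : γ' ∈ GraphClosure G := ⟨hγ', _, fun _ => hgG _, hconv⟩
    have heq : γ' a = γ a := tendsto_nhds_unique (hconv.tendsto_at ha)
      (hglim.comp (hns.comp hφ.tendsto_atTop))
    exact ⟨φ, hunbr γ' hmem heq hb ▸ hconv.tendsto_at hb⟩
  · exfalso
    have hnorm : Tendsto (fun j => ‖g (ns (φ j)) a‖) atTop (nhds ‖γ a‖) :=
      (hglim.comp (hns.comp hφ.tendsto_atTop)).norm
    obtain ⟨j, hj, hj'⟩ := ((hinf {a} (singleton_subset_iff.2 ha) isCompact_singleton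
      (‖γ a‖ + 1)).and (hnorm.eventually_lt_const (lt_add_one ‖γ a‖))).exists
    exact (hj a rfl).not_gt hj'

open Classical in
/-- The transport map of a family of graphs, sending `γ a` to `γ b`. -/
noncomputable def graphTransport (F : Set (ℂ → ℂ × ℂ)) (a b : ℂ) (x : ℂ × ℂ) : ℂ × ℂ :=
  if hx : ∃ γ ∈ F, γ a = x then hx.choose b else 0

lemma graphTransport_apply {F : Set (ℂ → ℂ × ℂ)} {a b : ℂ} {γ : ℂ → ℂ × ℂ} (hγ : γ ∈ F)
    (hF : ∀ γ' ∈ F, γ' a = γ a → γ' b = γ b) : graphTransport F a b (γ a) = γ b := by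
  have hx : ∃ γ' ∈ F, γ' a = γ a := ⟨γ, hγ, rfl⟩
  rw [graphTransport, dif_pos hx]
  exact hF _ hx.choose_spec.1 hx.choose_spec.2

lemma continuousOn_graphTransport {G : Set (ℂ → ℂ × ℂ)} (hG : IsNormalGraphFamily G)
    {a b : ℂ} (ha : a ∈ ball (0 : ℂ) 1) (hb : b ∈ ball (0 : ℂ) 1)
    (hunbr : ∀ γ ∈ GraphClosure G, ∀ γ' ∈ GraphClosure G,
      γ a = γ' a → EqOn γ γ' (ball 0 1)) :
    ContinuousOn (graphTransport (GraphClosure G) a b) ((fun γ => γ a) '' GraphClosure G) := by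
  have happly : ∀ γ ∈ GraphClosure G, graphTransport (GraphClosure G) a b (γ a) = γ b :=
    fun γ hγ => graphTransport_apply hγ fun γ' hγ' h => hunbr γ' hγ' γ hγ h hb
  rw [continuousOn_iff_continuous_domRestrict, continuous_iff_seqContinuous]
  rintro x ⟨_, γ, hγ, rfl⟩ hx
  choose u hu hux using fun n => (x n).2
  rw [tendsto_subtype_rng] at hx
  simp only [← hux] at hx
  have hlim := tendsto_eval_of_tendsto_eval hG ha hb (fun γ' hγ' h => hunbr γ' hγ' γ hγ h) hu hx
  simpa only [Function.comp_def, domRestrict_apply, ← hux, happly _ hγ, happly _ (hu _)] using hlim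

/-- **Corollary.** Let `𝒢` be a normal family of graphs such that `𝒢̄` is unbranched at
every parameter `λ ∈ 𝔻`. Then for every `λ` the map `h_λ : 𝒢̄_0 → 𝒢̄_λ`,
`γ(0) ↦ γ(λ)`, is a well-defined homeomorphism. -/
theorem motion_homeomorphism_of_unbranched
    (G : Set (ℂ → ℂ × ℂ))
    (hGhol : ∀ γ ∈ G, DifferentiableOn ℂ γ (Metric.ball 0 1))
    (hGnormal : IsNormalGraphFamily G)
    (hunbr : ∀ lam ∈ Metric.ball (0 : ℂ) 1, ∀ γ ∈ GraphClosure G, ∀ γ' ∈ GraphClosure G,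
      γ lam = γ' lam → Set.EqOn γ γ' (Metric.ball 0 1)) :
    ∃ h h' : ℂ → ℂ × ℂ → ℂ × ℂ,
      (∀ lam ∈ Metric.ball (0 : ℂ) 1, ∀ γ ∈ GraphClosure G,
        h lam (γ 0) = γ lam ∧ h' lam (γ lam) = γ 0) ∧
      (∀ lam ∈ Metric.ball (0 : ℂ) 1,
        Set.BijOn (h lam) ((fun γ => γ 0) '' GraphClosure G)
          ((fun γ => γ lam) '' GraphClosure G)) ∧
      (∀ lam ∈ Metric.ball (0 : ℂ) 1,
        ContinuousOn (h lam) ((fun γ => γ 0) '' GraphClosure G)) ∧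
      (∀ lam ∈ Metric.ball (0 : ℂ) 1,
        ContinuousOn (h' lam) ((fun γ => γ lam) '' GraphClosure G)) := by
  have h0 : (0 : ℂ) ∈ ball (0 : ℂ) 1 := mem_ball_self one_pos
  have happly : ∀ a ∈ ball (0 : ℂ) 1, ∀ b ∈ ball (0 : ℂ) 1, ∀ γ ∈ GraphClosure G,
      graphTransport (GraphClosure G) a b (γ a) = γ b := fun a ha b hb γ hγ =>
    graphTransport_apply hγ fun γ' hγ' h => hunbr a ha γ' hγ' γ hγ h hb
  refine ⟨graphTransport (GraphClosure G) 0, fun lam => graphTransport (GraphClosure G) lam 0,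
    fun lam hlam γ hγ => ⟨happly 0 h0 lam hlam γ hγ, happly lam hlam 0 h0 γ hγ⟩,
    fun lam hlam => ⟨?_, ?_, ?_⟩,
    fun lam hlam => continuousOn_graphTransport hGnormal h0 hlam (hunbr 0 h0),
    fun lam hlam => continuousOn_graphTransport hGnormal hlam h0 (hunbr lam hlam)⟩
  · rintro _ ⟨γ, hγ, rfl⟩
    exact ⟨γ, hγ, (happly 0 h0 lam hlam γ hγ).symm⟩
  · rintro _ ⟨γ, hγ, rfl⟩ _ ⟨γ', hγ', rfl⟩ h
    simp only [happly 0 h0 lam hlam _ hγ, happly 0 h0 lam hlam _ hγ'] at h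
    exact hunbr lam hlam γ hγ γ' hγ' h h0
  · rintro _ ⟨γ, hγ, rfl⟩
    exact ⟨γ 0, ⟨γ, hγ, rfl⟩, happly 0 h0 lam hlam γ hγ⟩
end
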